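/- arXiv:0801.1418 — 2 statements merged into one kernel-verified Lean document; each statement's English description precedes it below -/
import Mathlib

section
/- Let A = (A_1, …, A_r) ∈ Z^r with Σ_i A_i = 0, all A_i nonzero, and k_A = gcd(A_1, …, A_r). If there exists a triple of permutations (σ_1, σ_2, σ_3) in S_{n_A} with σ_1σ_2σ_3 = 1, generating a transitive subgroup, such that σ_1 has cycle type given by the positive A_i (and fixed points), σ_2 is an (r−1)-cycle (times fixed points), and σ_3 has cycle type given by the −A_i for negative A_i (and fixed points), then k_A · (r − 1) ≤ n_A, where n_A = Σ_i max(A_i, 0). -/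
open Equiv.Perm in
open Classical in
theorem aux_fixed {r n : ℕ} (B : Fin r → ℤ) (hn : (n : ℤ) = ∑ i, max (B i) 0)
    (σ : Equiv.Perm (Fin n))
    (hc : σ.cycleType = (Finset.univ.filter (fun i => 2 ≤ B i)).val.map (fun i => (B i).toNat)) :
    σ.supportᶜ.card = (Finset.univ.filter (fun i => B i = 1)).card := by
  have h1 := σ.sum_cycleType
  have h2 : σ.supportᶜ.card + σ.support.card = n := by
    rw [Finset.card_compl_add_card]; simp
  rw [hc] at h1
  have h3 : (∑ i ∈ Finset.univ.filter (fun i => 2 ≤ B i), (B i).toNat) = σ.support.card := h1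
  have h4 : (σ.support.card : ℤ) = ∑ i, if 2 ≤ B i then B i else 0 := by
    rw [← h3, ← Finset.sum_filter]
    push_cast
    apply Finset.sum_congr rfl
    intro i hi
    simp at hi
    omega
  have h5 : ((Finset.univ.filter (fun i => B i = 1)).card : ℤ) = ∑ i, if B i = 1 then 1 else 0 := by
    simp
  have h6 : (n : ℤ) = (∑ i, if 2 ≤ B i then B i else 0) + ∑ i, if B i = 1 then (1 : ℤ) else 0 := by
    rw [hn, ← Finset.sum_add_distrib]
    apply Finset.sum_congr rfl
    intro i _
    split_ifs <;> omega
  zify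
  zify at h2
  omega

open Equiv.Perm in
open Classical in
theorem aux_quot {r n : ℕ} (B : Fin r → ℤ) (hn : (n : ℤ) = ∑ i, max (B i) 0)
    (σ : Equiv.Perm (Fin n))
    (hc : σ.cycleType = (Finset.univ.filter (fun i => 2 ≤ B i)).val.map (fun i => (B i).toNat)) :
    (Finset.univ.filter (fun i => 0 < B i)).card ≤ Nat.card (Quotient (SameCycle.setoid σ)) := by
  have hf := aux_fixed B hn σ hc
  have hcy : σ.cycleFactorsFinset.card = (Finset.univ.filter (fun i => 2 ≤ B i)).card := by
    have := congrArg Multiset.card hc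
    rw [cycleType_def, Multiset.card_map, Multiset.card_map] at this
    exact this
  have hsplit : (Finset.univ.filter (fun i => 0 < B i)).card
      = (Finset.univ.filter (fun i => 2 ≤ B i)).card
        + (Finset.univ.filter (fun i => B i = 1)).card := by
    rw [← Finset.card_union_of_disjoint]
    · congr 1
      ext i
      simp
      omega
    · rw [Finset.disjoint_filter]
      intro i _ h1 h2
      omega
  rw [hsplit, ← hcy, ← hf]
  let g : σ.cycleFactorsFinset ⊕ (σ.supportᶜ : Finset (Fin n)) → Quotient (SameCycle.setoid σ) :=
    Sum.elim (fun c => Quotient.mk _ ((mem_cycleFactorsFinset_iff.mp c.2).1.nonempty_support.choose))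
      (fun x => Quotient.mk _ x.1)
  have hg : Function.Injective g := by
    have hch : ∀ c : σ.cycleFactorsFinset,
        (mem_cycleFactorsFinset_iff.mp c.2).1.nonempty_support.choose ∈ c.1.support := fun c =>
      (mem_cycleFactorsFinset_iff.mp c.2).1.nonempty_support.choose_spec
    have hcs : ∀ c : σ.cycleFactorsFinset, c.1.support ≤ σ.support := fun c =>
      mem_cycleFactorsFinset_support_le c.2
    rintro (c | x) (c' | y) h
    · have h' := Quotient.exact h
      change SameCycle σ _ _ at h'
      have e1 := cycle_is_cycleOf (hch c) c.2
      have e2 := cycle_is_cycleOf (hch c') c'.2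
      congr 1
      apply Subtype.ext
      rw [e1, e2]
      exact h'.cycleOf_eq
    · have h' := Quotient.exact h
      change SameCycle σ _ _ at h'
      exfalso
      have a1 := hcs c (hch c)
      have a2 := y.2
      rw [Finset.mem_compl, notMem_support] at a2
      rw [mem_support] at a1
      exact a1 ((h'.apply_eq_self_iff).mpr a2)
    · have h' := Quotient.exact h
      change SameCycle σ _ _ at h'
      exfalso
      have a1 := hcs c' (hch c')
      have a2 := x.2
      rw [Finset.mem_compl, notMem_support] at a2
      rw [mem_support] at a1
      exact a1 ((h'.apply_eq_self_iff).mp a2)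
    · have h' := Quotient.exact h
      change SameCycle σ _ _ at h'
      congr 1
      apply Subtype.ext
      have a2 := x.2
      rw [Finset.mem_compl, notMem_support] at a2
      exact h'.eq_of_left a2
  have := Nat.card_le_card_of_injective g hg
  rw [Nat.card_sum, Nat.card_eq_fintype_card, Nat.card_eq_fintype_card, Fintype.card_coe,
    Fintype.card_coe] at this
  exact this

open Equiv.Perm in
open Classical in
theorem aux_dvd {r n : ℕ} (B : Fin r → ℤ) (hn : (n : ℤ) = ∑ i, max (B i) 0)
    (σ : Equiv.Perm (Fin n))
    (hc : σ.cycleType = (Finset.univ.filter (fun i => 2 ≤ B i)).val.map (fun i => (B i).toNat))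
    (k : ℕ) (hk : ∀ i, (k : ℤ) ∣ B i) (P : Finset (Fin n)) (hP : ∀ x y, SameCycle σ x y → (x ∈ P ↔ y ∈ P)) :
    k ∣ P.card := by
  have hcl : ∀ x, k ∣ (Finset.univ.filter (fun y => SameCycle σ x y)).card := by
    intro x
    by_cases hx : σ x = x
    · have hf := aux_fixed B hn σ hc
      have : 0 < σ.supportᶜ.card := Finset.card_pos.mpr ⟨x, by simpa using hx⟩
      rw [hf, Finset.card_pos] at this
      obtain ⟨i, hi⟩ := this
      have hi : B i = 1 := by simpa using hi
      have := hk i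
      rw [hi] at this
      have : k = 1 := by
        have := Int.natAbs_dvd_natAbs.mpr this
        simpa using this
      rw [this]; exact one_dvd _
    · have h1 : (Finset.univ.filter (fun y => SameCycle σ x y)) = (σ.cycleOf x).support := by
        ext y
        rw [mem_support_cycleOf_iff]
        simp [hx]
      have h2 : (σ.cycleOf x).support.card ∈ σ.cycleType := by
        rw [cycleType_def]
        exact Multiset.mem_map_of_mem _ (Finset.mem_val.mpr <| cycleOf_mem_cycleFactorsFinset_iff.mpr (mem_support.mpr hx))
      rw [hc, Multiset.mem_map] at h2
      obtain ⟨i, hi, he⟩ := h2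
      rw [h1, ← he]
      have hi : 2 ≤ B i := by simpa using hi
      have := hk i
      zify
      rwa [Int.toNat_of_nonneg (by omega)]
  rw [Finset.card_eq_sum_card_image (fun x => (Quotient.mk (SameCycle.setoid σ) x)) P]
  apply Finset.dvd_sum
  intro q hq
  obtain ⟨x, hx, rfl⟩ := Finset.mem_image.mp hq
  refine (congrArg (fun F : Finset (Fin n) => k ∣ F.card) ?_).mpr (hcl x)
  ext y
  simp only [Finset.mem_filter, Finset.mem_univ, true_and]
  constructor
  · rintro ⟨_, h⟩
    exact (Quotient.exact h : SameCycle σ y x).symm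
  · intro h
    exact ⟨(hP x y h).mp hx, Quotient.sound (h.symm : SameCycle σ y x)⟩

theorem aux_closed {n : ℕ} (σ1 σ2 σ3 : Equiv.Perm (Fin n))
    (htrans : ∀ x y : Fin n, ∃ g ∈ Subgroup.closure {σ1, σ2, σ3}, g x = y)
    (T : Set (Fin n)) (h1 : ∀ x, x ∈ T ↔ σ1 x ∈ T) (h2 : ∀ x, x ∈ T ↔ σ2 x ∈ T)
    (h3 : ∀ x, x ∈ T ↔ σ3 x ∈ T) (x y : Fin n) (hx : x ∈ T) : y ∈ T := by
  obtain ⟨g, hg, rfl⟩ := htrans x y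
  have : ∀ x, x ∈ T ↔ g x ∈ T := by
    induction hg using Subgroup.closure_induction with
    | mem g hg =>
      rcases hg with rfl | rfl | rfl
      exacts [h1, h2, h3]
    | one => simp
    | mul a b _ _ ha hb => intro x; rw [hb x, ha]; rfl
    | inv a _ ha => intro x; rw [ha (a⁻¹ x)]; simp
  exact (this x).mp hx

theorem aux_fwd {α : Type*} [Finite α] (σ : Equiv.Perm α) (T : Set α) (h : ∀ x ∈ T, σ x ∈ T) (x : α) :
    x ∈ T ↔ σ x ∈ T := by
  refine ⟨h x, fun hx => ?_⟩
  have : σ '' T = T := by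
    apply Set.eq_of_subset_of_ncard_le
    · rintro _ ⟨y, hy, rfl⟩; exact h y hy
    · rw [Set.ncard_image_of_injective _ σ.injective]
    · exact Set.toFinite _
  rw [← this] at hx
  obtain ⟨y, hy, e⟩ := hx
  exact σ.injective e ▸ hy

/-- A set which is forward-closed under `σ1` off the support of `σ2` and misses it is empty. -/
theorem aux_empty {n : ℕ} (σ1 σ2 σ3 : Equiv.Perm (Fin n)) (hprod : σ1 * σ2 * σ3 = 1)
    (htrans : ∀ x y : Fin n, ∃ g ∈ Subgroup.closure {σ1, σ2, σ3}, g x = y)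
    (s : Fin n) (hs : σ2 s ≠ s)
    (T : Set (Fin n)) (h1 : ∀ x ∈ T, σ2 x = x → σ1 x ∈ T) (h2 : ∀ x ∈ T, σ2 x = x) (x : Fin n) :
    x ∉ T := by
  intro hx
  have k1 := aux_fwd σ1 T (fun x hx => h1 x hx (h2 x hx))
  have k2 := aux_fwd σ2 T (fun x hx => by rwa [h2 x hx])
  refine hs (h2 s (aux_closed σ1 σ2 σ3 htrans T k1 k2 ?_ x s hx))
  intro x
  rw [k2 (σ3 x), k1 (σ2 (σ3 x))]
  have : σ1 (σ2 (σ3 x)) = x := by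
    have := congrArg (fun g : Equiv.Perm (Fin n) => g x) hprod
    simpa using this
  rw [this]

open Equiv.Perm in
open Classical in
theorem aux_sep {n r : ℕ} (σ1 σ2 σ3 : Equiv.Perm (Fin n)) (hprod : σ1 * σ2 * σ3 = 1)
    (htrans : ∀ x y : Fin n, ∃ g ∈ Subgroup.closure {σ1, σ2, σ3}, g x = y)
    (hS : σ2.support.card + 1 = r)
    (hq : r ≤ Nat.card (Quotient (SameCycle.setoid σ1)) + Nat.card (Quotient (SameCycle.setoid σ3)))
    (s : Fin n) (hs : σ2 s ≠ s) :
    ∃ P Q : Finset (Fin n), (∀ x y, SameCycle σ1 x y → (x ∈ P ↔ y ∈ P)) ∧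
      (∀ x y, SameCycle σ3 x y → (x ∈ Q ↔ y ∈ Q)) ∧ s ∈ P ∧ s ∉ Q ∧
      (∀ t, σ2 t ≠ t → t ≠ s → (t ∈ P ↔ t ∈ Q)) := by
  let a : Fin n → Quotient (SameCycle.setoid σ1) ⊕ Quotient (SameCycle.setoid σ3) :=
    fun x => Sum.inl (Quotient.mk _ x)
  let b : Fin n → Quotient (SameCycle.setoid σ1) ⊕ Quotient (SameCycle.setoid σ3) :=
    fun x => Sum.inr (Quotient.mk _ x)
  have ha : ∀ x y, SameCycle σ1 x y → a x = a y := fun x y h =>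
    congrArg Sum.inl (Quotient.sound h)
  have hb : ∀ x y, SameCycle σ3 x y → b x = b y := fun x y h =>
    congrArg Sum.inr (Quotient.sound h)
  have hσ : ∀ x, σ3 (σ1 (σ2 x)) = x := by
    intro x
    have h : σ3 * (σ1 * σ2) = 1 := by rw [mul_eq_one_iff_eq_inv'] at *; simp [hprod]
    have := congrArg (fun g : Equiv.Perm (Fin n) => g x) h
    simpa using this
  let E : Finset (Sym2 (Quotient (SameCycle.setoid σ1) ⊕ Quotient (SameCycle.setoid σ3))) :=
    (σ2.support.erase s).image (fun x => s(a x, b x))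
  let G := SimpleGraph.fromEdgeSet (E : Set (Sym2 (Quotient (SameCycle.setoid σ1) ⊕ Quotient (SameCycle.setoid σ3))))
  have hadj : ∀ t, σ2 t ≠ t → t ≠ s → G.Reachable (a t) (b t) := by
    intro t h1 h2
    apply SimpleGraph.Adj.reachable
    rw [SimpleGraph.fromEdgeSet_adj]
    refine ⟨?_, by simp [a, b]⟩
    exact Finset.mem_coe.mpr (Finset.mem_image.mpr ⟨t, by simp [h1, h2], rfl⟩)
  have hnr : ¬ G.Reachable (a s) (b s) := by
    intro hrs
    have hall : ∀ x, G.Reachable (a x) (b x) := by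
      intro x
      by_contra hx
      refine aux_empty σ1 σ2 σ3 hprod htrans s hs {x | ¬ G.Reachable (a x) (b x)} ?_ ?_ x hx
      · intro y hy h2
        have e1 : a (σ1 y) = a y := ha _ _ (sameCycle_apply_left.mpr (SameCycle.refl _ _))
        have e2 : b (σ1 y) = b y := by
          have h3 := hσ y
          rw [h2] at h3
          apply hb
          rw [← sameCycle_apply_left, h3]
        simp only [Set.mem_ofPred_eq, e1, e2]
        exact hy
      · intro y hy
        by_contra h2
        by_cases hys : y = s
        · subst hys; exact hy hrs
        · exact hy (hadj y h2 hys)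
    have hall2 : ∀ x, G.Reachable (a s) (a x) := by
      have k1 : ∀ x, x ∈ {x | G.Reachable (a s) (a x)} ↔ σ1 x ∈ {x | G.Reachable (a s) (a x)} := by
        intro x
        simp only [Set.mem_ofPred_eq]
        rw [ha (σ1 x) x (sameCycle_apply_left.mpr (SameCycle.refl _ _))]
      have k3 : ∀ x, x ∈ {x | G.Reachable (a s) (a x)} ↔ σ3 x ∈ {x | G.Reachable (a s) (a x)} := by
        intro x
        simp only [Set.mem_ofPred_eq]
        have e := hb (σ3 x) x (sameCycle_apply_left.mpr (SameCycle.refl _ _))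
        have e1 := hall x
        have e2 := hall (σ3 x)
        rw [e] at e2
        exact ⟨fun h => (h.trans e1).trans e2.symm, fun h => (h.trans e2).trans e1.symm⟩
      intro x
      refine aux_closed σ1 σ2 σ3 htrans {x | G.Reachable (a s) (a x)} k1 ?_ k3 s x
        (SimpleGraph.Reachable.refl _)
      intro x
      rw [k1 (σ2 x), k3 (σ1 (σ2 x)), hσ]
    have hconn : G.Connected := by
      rw [SimpleGraph.connected_iff_exists_forall_reachable]
      refine ⟨a s, ?_⟩
      rintro (q | q)
      · induction q using Quotient.inductionOn with
        | h x => exact hall2 x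
      · induction q using Quotient.inductionOn with
        | h x => exact (hall2 x).trans (hall x)
    have hcard := hconn.card_vert_le_card_edgeSet_add_one
    have h1 : Nat.card G.edgeSet ≤ E.card := by
      have : G.edgeSet ⊆ (E : Set _) := by
        rw [SimpleGraph.edgeSet_fromEdgeSet]; exact Set.sdiff_subset
      have := Set.ncard_le_ncard this (Set.toFinite _)
      rwa [Set.ncard_coe_finset] at this
    have h2 : E.card ≤ (σ2.support.erase s).card := Finset.card_image_le
    have h3 : (σ2.support.erase s).card + 1 = σ2.support.card :=
      Finset.card_erase_add_one (mem_support.mpr hs)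
    rw [Nat.card_sum] at hcard
    omega
  refine ⟨Finset.univ.filter (fun x => G.Reachable (a s) (a x)),
    Finset.univ.filter (fun x => G.Reachable (a s) (b x)), ?_, ?_, ?_, ?_, ?_⟩
  · intro x y h; simp [ha x y h]
  · intro x y h; simp [hb x y h]
  · simp
  · simpa using hnr
  · intro t h1 h2
    have := hadj t h1 h2
    simp only [Finset.mem_filter, Finset.mem_univ, true_and]
    exact ⟨fun h => h.trans this, fun h => h.trans this.symm⟩


open Classical in
/-- Let `A ∈ ℤ^r` with `∑ A i = 0`, all `A i ≠ 0`, `n_A = ∑ max(A i, 0)` and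
`k_A = gcd(A 1, …, A r)`.  If there is a generating system `(σ1, σ2, σ3)` of degree `n_A`
(i.e. `σ1 σ2 σ3 = 1` and `⟨σ1, σ2, σ3⟩` transitive) with `σ1` of cycle type the positive
`A i` (plus fixed points), `σ2` an `(r-1)`-cycle (plus fixed points) and `σ3` of cycle type
the `-A i` for negative `A i` (plus fixed points), then `k_A · (r - 1) ≤ n_A`.  (Mathlib's
`cycleType` omits fixed points, so entries equal to `1` are filtered out.) -/
theorem stmt9 (r : ℕ) (hr : 2 ≤ r) (A : Fin r → ℤ) (hA0 : ∀ i, A i ≠ 0)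
    (hsum : ∑ i, A i = 0) (nA : ℕ) (hnA : (nA : ℤ) = ∑ i, max (A i) 0)
    (σ1 σ2 σ3 : Equiv.Perm (Fin nA))
    (hprod : σ1 * σ2 * σ3 = 1)
    (htrans : ∀ x y : Fin nA, ∃ g ∈ Subgroup.closure {σ1, σ2, σ3}, g x = y)
    (hc1 : σ1.cycleType
      = (Finset.univ.filter (fun i => 2 ≤ A i)).val.map (fun i => (A i).toNat))
    (hc2 : σ2.cycleType = ({r - 1} : Multiset ℕ).filter (fun x => 2 ≤ x))
    (hc3 : σ3.cycleType
      = (Finset.univ.filter (fun i => A i ≤ -2)).val.map (fun i => (-A i).toNat)) :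
    Finset.univ.gcd A * ((r : ℤ) - 1) ≤ ∑ i, max (A i) 0 := by
  have hnA3 : (nA : ℤ) = ∑ i, max (-A i) 0 := by
    have : ∑ i, max (A i) 0 = ∑ i, (A i + max (-A i) 0) := by
      apply Finset.sum_congr rfl
      intro i _
      omega
    rw [hnA, this, Finset.sum_add_distrib, hsum, zero_add]
  have hc3' : σ3.cycleType
      = (Finset.univ.filter (fun i => 2 ≤ -A i)).val.map (fun i => (-A i).toNat) := by
    rw [hc3]
    congr 2
    ext i
    simp
    omega
  set k : ℕ := (Finset.univ.gcd A).natAbs with hkdef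
  have hk : ∀ i, (k : ℤ) ∣ A i := fun i => by
    rw [hkdef, Int.natAbs_dvd]
    exact Finset.gcd_dvd (Finset.mem_univ i)
  have hk3 : ∀ i, (k : ℤ) ∣ -A i := fun i => (dvd_neg).mpr (hk i)
  suffices hmain : k * (r - 1) ≤ nA by
    rw [← hnA]
    have h1 : Finset.univ.gcd A * ((r : ℤ) - 1) ≤ (k : ℤ) * ((r : ℤ) - 1) :=
      mul_le_mul_of_nonneg_right Int.le_natAbs (by omega)
    have h2 : ((k * (r - 1) : ℕ) : ℤ) ≤ nA := by exact_mod_cast hmain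
    rw [Nat.cast_mul, Nat.cast_sub (by omega)] at h2
    push_cast at h2
    omega
  by_cases hr2 : r = 2
  · have hdvd : (k : ℤ) ∣ nA := by
      rw [hnA]
      apply Finset.dvd_sum
      intro i _
      rcases max_choice (A i) 0 with h | h <;> rw [h]
      · exact hk i
      · exact dvd_zero _
    have hpos : 0 < nA := by
      rcases Nat.eq_zero_or_pos nA with h0 | h0
      · exfalso
        rw [h0] at hnA hnA3
        have i : Fin r := ⟨0, by omega⟩
        have e1 := (Finset.sum_eq_zero_iff_of_nonneg (fun i _ => le_max_right (A i) 0)).mp hnA.symm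
          i (Finset.mem_univ i)
        have e2 := (Finset.sum_eq_zero_iff_of_nonneg (fun i _ => le_max_right (-A i) 0)).mp hnA3.symm
          i (Finset.mem_univ i)
        have := hA0 i
        omega
      · exact h0
    subst hr2
    simpa using Nat.le_of_dvd hpos (by exact_mod_cast hdvd)
  have hS : σ2.support.card + 1 = r := by
    have := σ2.sum_cycleType
    rw [hc2, Multiset.filter_singleton, if_pos (by omega)] at this
    simp at this
    omega
  have hq : r ≤ Nat.card (Quotient (Equiv.Perm.SameCycle.setoid σ1))
      + Nat.card (Quotient (Equiv.Perm.SameCycle.setoid σ3)) := by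
    have q1 := aux_quot A hnA σ1 hc1
    have q3 := aux_quot (fun i => -A i) hnA3 σ3 hc3'
    have : (Finset.univ.filter (fun i => 0 < A i)).card
        + (Finset.univ.filter (fun i => 0 < -A i)).card = r := by
      rw [← Finset.card_union_of_disjoint]
      · rw [← Finset.filter_or, Finset.filter_true_of_mem]
        · simp
        · intro i _
          have := hA0 i
          omega
      · rw [Finset.disjoint_filter]
        intro i _ h1 h2
        omega
    omega
  have hsep := aux_sep σ1 σ2 σ3 hprod htrans hS hq
  choose! P Q hP hQ hsP hsQ hPQ using hsep
  have hstep1 : ∀ s, σ2 s ≠ s → ∀ x, x ∈ P s ↔ σ1 x ∈ P s := fun s hs x =>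
    hP s hs _ _ (Equiv.Perm.sameCycle_apply_right.mpr (Equiv.Perm.SameCycle.refl _ _))
  have hstep3 : ∀ s, σ2 s ≠ s → ∀ x, σ2 x = x → (x ∈ Q s ↔ σ1 x ∈ Q s) := by
    intro s hs x hx
    apply hQ s hs
    have h : σ3 * (σ1 * σ2) = 1 := by rw [mul_eq_one_iff_eq_inv'] at *; simp [hprod]
    have := congrArg (fun g : Equiv.Perm (Fin nA) => g x) h
    simp [hx] at this
    rw [← Equiv.Perm.sameCycle_apply_right, this]
  have hsub : ∀ s, σ2 s ≠ s → Q s ⊆ P s := by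
    intro s hs x hx
    by_contra hxP
    refine aux_empty σ1 σ2 σ3 hprod htrans s hs {x | x ∈ Q s ∧ x ∉ P s} ?_ ?_ x ⟨hx, hxP⟩
    · rintro y ⟨h1, h2⟩ h3
      exact ⟨(hstep3 s hs y h3).mp h1, fun h => h2 ((hstep1 s hs y).mpr h)⟩
    · rintro y ⟨h1, h2⟩
      by_contra h3
      by_cases hys : y = s
      · subst hys; exact hsQ _ hs h1
      · exact h2 ((hPQ s hs y h3 hys).mpr h1)
  have hcard : ∀ s ∈ σ2.support, k ≤ (P s \ Q s).card := by
    intro s hs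
    rw [Equiv.Perm.mem_support] at hs
    apply Nat.le_of_dvd
    · exact Finset.card_pos.mpr ⟨s, Finset.mem_sdiff.mpr ⟨hsP s hs, hsQ s hs⟩⟩
    · rw [Finset.card_sdiff_of_subset (hsub s hs)]
      exact Nat.dvd_sub (aux_dvd A hnA σ1 hc1 k hk _ (hP s hs))
        (aux_dvd (fun i => -A i) hnA3 σ3 hc3' k hk3 _ (hQ s hs))
  have hdisj : ∀ s ∈ σ2.support, ∀ t ∈ σ2.support, s ≠ t → Disjoint (P s \ Q s) (P t \ Q t) := by
    intro s hs t ht hst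
    rw [Equiv.Perm.mem_support] at hs ht
    rw [Finset.disjoint_left]
    intro x hx hx'
    refine aux_empty σ1 σ2 σ3 hprod htrans s hs {x | x ∈ P s \ Q s ∧ x ∈ P t \ Q t} ?_ ?_ x ⟨hx, hx'⟩
    · rintro y ⟨h1, h2⟩ h3
      rw [Finset.mem_sdiff] at h1 h2
      refine ⟨Finset.mem_sdiff.mpr ⟨(hstep1 s hs y).mp h1.1, fun h => h1.2 ((hstep3 s hs y h3).mpr h)⟩,
        Finset.mem_sdiff.mpr ⟨(hstep1 t ht y).mp h2.1, fun h => h2.2 ((hstep3 t ht y h3).mpr h)⟩⟩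
    · rintro y ⟨h1, h2⟩
      rw [Finset.mem_sdiff] at h1 h2
      by_contra h3
      by_cases hys : y = s
      · exact h2.2 ((hPQ t ht y h3 (hys ▸ hst)).mp h2.1)
      · exact h1.2 ((hPQ s hs y h3 hys).mp h1.1)
  calc k * (r - 1) = ∑ s ∈ σ2.support, k := by
        rw [Finset.sum_const, smul_eq_mul, mul_comm]; congr 1; omega
    _ ≤ ∑ s ∈ σ2.support, (P s \ Q s).card := Finset.sum_le_sum hcard
    _ = (σ2.support.biUnion (fun s => P s \ Q s)).card := (Finset.card_biUnion hdisj).symm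
    _ ≤ nA := by simpa using Finset.card_le_univ (σ2.support.biUnion (fun s => P s \ Q s))
end

section
/- Let A = (A_1, …, A_r) ∈ Z^r with Σ_i A_i = 0, all A_i nonzero, n_A = Σ_i max(A_i, 0), and k_A = gcd(A_1, …, A_r). If k_A · (r − 1) ≤ n_A, then there exists a triple of permutations (σ_1, σ_2, σ_3) in S_{n_A} with σ_1σ_2σ_3 = 1, generating a transitive subgroup, where σ_1 has cycle type the positive A_i (plus fixed points), σ_2 is an (r−1)-cycle (plus fixed points), and σ_3 has cycle type the absolute values of the negative A_i (plus fixed points). -/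
/-- Weighted bipartite trees, recorded by the signed vertex weights and the edge weights. -/
inductive WTree : Multiset ℤ → Multiset ℕ → Prop
  | base (a : ℕ) (ha : 0 < a) : WTree {(a : ℤ), -(a : ℤ)} {a}
  | glue (a b : ℤ) (S T : Multiset ℤ) (E F : Multiset ℕ) (hab : 0 < a * b)
      (h1 : WTree (a ::ₘ S) E) (h2 : WTree (b ::ₘ T) F) :
      WTree ((a + b) ::ₘ (S + T)) (E + F)

lemma WTree.cast {S S' : Multiset ℤ} {E : Multiset ℕ} (h : WTree S E) (e : S = S') : WTree S' E :=
  e ▸ h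

/-- Replace an edge of weight `s` by a tree having vertices `s` and `-s`. -/
lemma WTree.subst {S : Multiset ℤ} {E : Multiset ℕ} (h : WTree S E) {s : ℕ} (hs : s ∈ E)
    {U : Multiset ℤ} {G : Multiset ℕ} (hU : WTree ((s : ℤ) ::ₘ (-(s : ℤ)) ::ₘ U) G) :
    ∃ E', WTree (S + U) E' := by
  induction h with
  | base a ha =>
    simp only [Multiset.mem_singleton] at hs
    subst hs
    exact ⟨_, hU.cast (by simp [Multiset.insert_eq_cons])⟩
  | glue a b S T E F hab h1 h2 ih1 ih2 =>
    rcases Multiset.mem_add.1 hs with h | h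
    · obtain ⟨E', hE'⟩ := ih1 h
      rw [Multiset.cons_add] at hE'
      exact ⟨_, (WTree.glue _ _ _ _ _ _ hab hE' h2).cast (by
        rw [Multiset.cons_add, add_right_comm])⟩
    · obtain ⟨E', hE'⟩ := ih2 h
      rw [Multiset.cons_add] at hE'
      exact ⟨_, (WTree.glue _ _ _ _ _ _ hab h1 hE').cast (by
        rw [Multiset.cons_add, add_assoc])⟩

/-- Stitching two trees along edges of different weight. -/
lemma WTree.stitch {S T : Multiset ℤ} {E F : Multiset ℕ} (h : WTree S E) (k : WTree T F)
    {s t : ℕ} (hs : s ∈ E) (ht : t ∈ F) (s0 : 0 < s) (hst : s < t) : ∃ E', WTree (S + T) E' := by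
  obtain ⟨d, rfl⟩ := Nat.exists_eq_add_of_lt hst
  have b1 := WTree.base s s0
  have b2 := WTree.base (d + 1) (by omega)
  have p1 : WTree (((s : ℤ) + ((d + 1 : ℕ) : ℤ)) ::ₘ ({-(s : ℤ)} + {-((d + 1 : ℕ) : ℤ)})) _ :=
    WTree.glue _ _ _ _ _ _ (by positivity) b1 b2
  have p2 := p1.cast (S' := (-((d + 1 : ℕ) : ℤ)) ::ₘ
    ({((s : ℤ) + ((d + 1 : ℕ) : ℤ)), -(s : ℤ)})) (by
      ext x; simp [Multiset.count_cons, Multiset.insert_eq_cons, Multiset.count_singleton]; ring)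
  have b3 := b1.cast (S' := (-(s : ℤ)) ::ₘ {(s : ℤ)}) (by
      ext x; simp [Multiset.count_cons, Multiset.insert_eq_cons, Multiset.count_singleton]; ring)
  have p3 := WTree.glue _ _ _ _ _ _ (by rw [neg_mul_neg]; positivity) p2 b3
  have p4 := p3.cast (S' := (s : ℤ) ::ₘ (-(s : ℤ)) ::ₘ
      {((s + d + 1 : ℕ) : ℤ), -((s + d + 1 : ℕ) : ℤ)}) (by
      have : (-((d + 1 : ℕ) : ℤ) + -(s : ℤ)) = -((s + d + 1 : ℕ) : ℤ) := by push_cast; ring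
      rw [this]
      have : ((s : ℤ) + ((d + 1 : ℕ) : ℤ)) = ((s + d + 1 : ℕ) : ℤ) := by push_cast; ring
      rw [this]
      ext x; simp only [Multiset.count_cons, Multiset.insert_eq_cons, Multiset.count_singleton,
        Multiset.count_add]; ring)
  obtain ⟨E1, h1⟩ := h.subst hs p4
  have h2 := h1.cast (S' := ((s + d + 1 : ℕ) : ℤ) ::ₘ (-((s + d + 1 : ℕ) : ℤ)) ::ₘ S) (by
      ext x; simp only [Multiset.count_cons, Multiset.insert_eq_cons, Multiset.count_singleton,
        Multiset.count_add]; ring)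
  obtain ⟨E2, h3⟩ := k.subst ht h2
  exact ⟨_, h3.cast (add_comm _ _)⟩

lemma max_add_same {a b : ℤ} (h : 0 < a * b) : max (a + b) 0 = max a 0 + max b 0 := by
  rcases pos_and_pos_or_neg_and_neg_of_mul_pos h with h | h <;> omega

lemma WTree.edge_pos {S : Multiset ℤ} {E : Multiset ℕ} (h : WTree S E) :
    E ≠ 0 ∧ (∀ s ∈ E, 0 < s) ∧ Multiset.card S = Multiset.card E + 1 ∧
    (S.map (fun a => max a 0)).sum = (E.sum : ℤ) ∧
    ∀ m : ℕ, (∀ s ∈ E, s = m) → ∀ a ∈ S, (m : ℤ) ∣ a := by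
  induction h with
  | base a ha =>
    refine ⟨by simp, by simpa, by simp, by simp, ?_⟩
    intro m hm
    simp at hm
    subst hm
    simp
  | glue a b S T E F hab h1 h2 ih1 ih2 =>
    obtain ⟨a1, a2, a3, a4, a5⟩ := ih1
    obtain ⟨b1, b2, b3, b4, b5⟩ := ih2
    simp only [Multiset.card_cons, Multiset.map_cons, Multiset.sum_cons] at a3 a4 b3 b4
    refine ⟨by simp [a1], ?_, ?_, ?_, ?_⟩
    · intro s hs
      rcases Multiset.mem_add.1 hs with h | h
      exacts [a2 s h, b2 s h]
    · simp; omega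
    · rw [Multiset.map_cons, Multiset.sum_cons, max_add_same hab, Multiset.map_add, Multiset.sum_add,
        Multiset.sum_add]
      rw [Nat.cast_add]
      linarith
    · intro m hm c hc
      have a6 := a5 m (fun s hs => hm s (Multiset.mem_add.2 (Or.inl hs)))
      have b6 := b5 m (fun s hs => hm s (Multiset.mem_add.2 (Or.inr hs)))
      simp only [Multiset.mem_cons, Multiset.mem_add] at hc a6 b6
      rcases hc with rfl | hc | hc
      · exact dvd_add (a6 _ (Or.inl rfl)) (b6 _ (Or.inl rfl))
      · exact a6 _ (Or.inr hc)
      · exact b6 _ (Or.inr hc)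

/-- Every zero-sum multiset of nonzero integers is realized by a forest. -/
lemma exists_forest (N : ℕ) : ∀ S : Multiset ℤ, Multiset.card S ≤ N → S.sum = 0 →
    (∀ a ∈ S, a ≠ 0) →
    ∃ L : Multiset (Multiset ℤ), L.sum = S ∧ ∀ T ∈ L, ∃ E, WTree T E := by
  induction N with
  | zero =>
    intro S hS _ _
    have : S = 0 := by simpa using hS
    subst this
    exact ⟨0, by simp⟩
  | succ N ih =>
    intro S hS h0 hne
    by_cases hS0 : S = 0
    · subst hS0
      exact ⟨0, by simp⟩
    obtain ⟨a, haS, ha⟩ : ∃ a ∈ S, 0 < a := by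
      by_contra! hcon
      obtain ⟨x, hx⟩ := Multiset.exists_mem_of_ne_zero hS0
      obtain ⟨S', rfl⟩ := Multiset.exists_cons_of_mem hx
      have h1 : x ≤ 0 := hcon x hx
      have h2 : x ≠ 0 := hne x hx
      have h3 : S'.sum ≤ 0 := by
        have := Multiset.sum_le_card_nsmul S' 0 (fun y hy => hcon y (Multiset.mem_cons_of_mem hy))
        simpa using this
      rw [Multiset.sum_cons] at h0
      omega
    obtain ⟨S1, rfl⟩ := Multiset.exists_cons_of_mem haS
    obtain ⟨b, hbS, hb⟩ : ∃ b ∈ S1, b < 0 := by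
      by_contra! hcon
      have h3 : 0 ≤ S1.sum := Multiset.sum_nonneg hcon
      rw [Multiset.sum_cons] at h0
      omega
    obtain ⟨S2, rfl⟩ := Multiset.exists_cons_of_mem hbS
    simp only [Multiset.card_cons, Multiset.sum_cons, Multiset.mem_cons] at hS h0 hne
    have hS2 : ∀ x ∈ S2, x ≠ 0 := fun x hx => hne x (Or.inr (Or.inr hx))
    rcases lt_trichotomy (a + b) 0 with hab | hab | hab
    · obtain ⟨L, hL, hT⟩ := ih ((a + b) ::ₘ S2) (by simp; omega) (by simp; omega) (by
        intro x hx
        rcases Multiset.mem_cons.1 hx with rfl | hx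
        exacts [by omega, hS2 x hx])
      have hmem : a + b ∈ L.sum := by rw [hL]; simp
      obtain ⟨T, hTL, hmT⟩ := Multiset.mem_join.1 hmem
      obtain ⟨L', rfl⟩ := Multiset.exists_cons_of_mem hTL
      obtain ⟨T', rfl⟩ := Multiset.exists_cons_of_mem hmT
      obtain ⟨E, hE⟩ := hT _ hTL
      lift a to ℕ using ha.le
      have hbase := (WTree.base a (by omega)).cast (S' := (-(a : ℤ)) ::ₘ {(a : ℤ)}) (by
        rw [Multiset.insert_eq_cons, ← Multiset.cons_zero, ← Multiset.cons_zero, Multiset.cons_swap])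
      have hg := WTree.glue _ _ _ _ _ _ (by nlinarith) hE hbase
      refine ⟨(((a : ℤ) + b + -a) ::ₘ (T' + {(a : ℤ)})) ::ₘ L', ?_, ?_⟩
      rotate_left
      · intro T hT1
        rcases Multiset.mem_cons.1 hT1 with rfl | hT1
        · exact ⟨_, hg⟩
        · exact hT T (Multiset.mem_cons_of_mem hT1)
      · rw [Multiset.sum_cons, Multiset.cons_add, Multiset.cons_inj_right] at hL
        rw [← hL, Multiset.sum_cons]
        have : (a : ℤ) + b + -a = b := by ring
        rw [this]
        ext x; simp only [Multiset.count_cons, Multiset.count_singleton, Multiset.count_add]; ring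
    · obtain ⟨L, hL, hT⟩ := ih S2 (by omega) (by omega) hS2
      lift a to ℕ using ha.le
      refine ⟨{(a : ℤ), -(a : ℤ)} ::ₘ L, ?_, ?_⟩
      · have : b = -(a : ℤ) := by omega
        rw [Multiset.sum_cons, hL, this]
        simp [Multiset.insert_eq_cons]
      · intro T hT1
        rcases Multiset.mem_cons.1 hT1 with rfl | hT1
        · exact ⟨_, WTree.base a (by omega)⟩
        · exact hT T hT1
    · obtain ⟨L, hL, hT⟩ := ih ((a + b) ::ₘ S2) (by simp; omega) (by simp; omega) (by
        intro x hx
        rcases Multiset.mem_cons.1 hx with rfl | hx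
        exacts [by omega, hS2 x hx])
      have hmem : a + b ∈ L.sum := by rw [hL]; simp
      obtain ⟨T, hTL, hmT⟩ := Multiset.mem_join.1 hmem
      obtain ⟨L', rfl⟩ := Multiset.exists_cons_of_mem hTL
      obtain ⟨T', rfl⟩ := Multiset.exists_cons_of_mem hmT
      obtain ⟨E, hE⟩ := hT _ hTL
      obtain ⟨c, rfl⟩ : ∃ c : ℕ, b = -(c : ℤ) := ⟨b.natAbs, by omega⟩
      have hbase : WTree ((c : ℤ) ::ₘ {-(c : ℤ)}) _ := WTree.base c (by omega)
      have hg := WTree.glue _ _ _ _ _ _ (by nlinarith) hE hbase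
      refine ⟨((a + -(c : ℤ) + c) ::ₘ (T' + {-(c : ℤ)})) ::ₘ L', ?_, ?_⟩
      rotate_left
      · intro T hT1
        rcases Multiset.mem_cons.1 hT1 with rfl | hT1
        · exact ⟨_, hg⟩
        · exact hT T (Multiset.mem_cons_of_mem hT1)
      · rw [Multiset.sum_cons, Multiset.cons_add, Multiset.cons_inj_right] at hL
        rw [← hL, Multiset.sum_cons]
        have : (a : ℤ) + -c + c = a := by ring
        rw [this]
        ext x; simp only [Multiset.count_cons, Multiset.count_singleton, Multiset.count_add]; ring

/-- The values of a forest all of whose edges have weight `m`. -/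
lemma forest_const (m : ℕ) (L : Multiset (Multiset ℤ))
    (h : ∀ T ∈ L, ∃ E, WTree T E ∧ ∀ s ∈ E, s = m) :
    (L.sum.map (fun a => max a 0)).sum + m * (Multiset.card L : ℤ)
      = m * (Multiset.card L.sum : ℤ) ∧ ∀ a ∈ L.sum, (m : ℤ) ∣ a := by
  induction L using Multiset.induction_on with
  | empty => simp
  | cons T L ih =>
    obtain ⟨i1, i2⟩ := ih (fun T hT => h T (Multiset.mem_cons_of_mem hT))
    obtain ⟨E, hE, hm⟩ := h T (Multiset.mem_cons_self _ _)
    obtain ⟨e1, e2, e3, e4, e5⟩ := hE.edge_pos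
    have hEr : E = Multiset.replicate (Multiset.card E) m := Multiset.eq_replicate_card.2 hm
    have hs : E.sum = Multiset.card E * m := by
      conv_lhs => rw [hEr]
      simp
    constructor
    · rw [Multiset.sum_cons, Multiset.map_add, Multiset.sum_add, e4, hs, Multiset.card_add, e3,
        Multiset.card_cons]
      push_cast
      linear_combination i1
    · intro a ha
      rw [Multiset.sum_cons, Multiset.mem_add] at ha
      rcases ha with ha | ha
      exacts [e5 m hm a ha, i2 a ha]

lemma forest_to_tree (d : ℤ) (S : Multiset ℤ) (hd : ∀ m : ℤ, (∀ a ∈ S, m ∣ a) → m ≤ d)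
    (hS : S ≠ 0) (hn : d * ((Multiset.card S : ℤ) - 1) ≤ (S.map (fun a => max a 0)).sum) (N : ℕ) :
    ∀ L : Multiset (Multiset ℤ), Multiset.card L ≤ N → L.sum = S →
      (∀ T ∈ L, ∃ E, WTree T E) → ∃ E, WTree S E := by
  induction N with
  | zero =>
    intro L hL hLS _
    have : L = 0 := by simpa using hL
    subst this
    exact absurd hLS.symm (by simpa using hS)
  | succ N ih =>
    intro L hL hLS hT
    by_cases h0 : L = 0
    · subst h0
      exact absurd hLS.symm (by simpa using hS)
    obtain ⟨T0, hT0⟩ := Multiset.exists_mem_of_ne_zero h0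
    obtain ⟨L1, rfl⟩ := Multiset.exists_cons_of_mem hT0
    by_cases h1 : L1 = 0
    · subst h1
      obtain ⟨E, hE⟩ := hT _ hT0
      exact ⟨E, hE.cast (by simpa using hLS)⟩
    by_cases hex : ∃ T1 ∈ L1, ∃ E0 E1, WTree T0 E0 ∧ WTree T1 E1 ∧ ∃ s ∈ E0, ∃ t ∈ E1, s ≠ t
    · obtain ⟨T1, hT1, E0, E1, hE0, hE1, s, hs, t, ht, hst⟩ := hex
      obtain ⟨L2, rfl⟩ := Multiset.exists_cons_of_mem hT1
      have hmerge : ∃ E', WTree (T0 + T1) E' := by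
        rcases lt_or_gt_of_ne hst with h | h
        · exact hE0.stitch hE1 hs ht (hE0.edge_pos.2.1 s hs) h
        · obtain ⟨E', h'⟩ := hE1.stitch hE0 ht hs (hE1.edge_pos.2.1 t ht) h
          exact ⟨E', h'.cast (add_comm _ _)⟩
      refine ih ((T0 + T1) ::ₘ L2) (by simpa using hL) (by simpa [add_assoc] using hLS) ?_
      intro T h
      rcases Multiset.mem_cons.1 h with rfl | h
      · exact hmerge
      · exact hT T (by simp [h])
    · exfalso
      push Not at hex
      obtain ⟨E0, hE0⟩ := hT _ hT0
      obtain ⟨m, hm⟩ := Multiset.exists_mem_of_ne_zero hE0.edge_pos.1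
      obtain ⟨T1, hT1⟩ := Multiset.exists_mem_of_ne_zero h1
      have hall : ∀ T ∈ T0 ::ₘ L1, ∃ E, WTree T E ∧ ∀ s ∈ E, s = m := by
        intro T h
        rcases Multiset.mem_cons.1 h with rfl | h
        · refine ⟨E0, hE0, fun s hs => ?_⟩
          obtain ⟨E1, hE1⟩ := hT T1 (Multiset.mem_cons_of_mem hT1)
          obtain ⟨u, hu⟩ := Multiset.exists_mem_of_ne_zero hE1.edge_pos.1
          rw [hex T1 hT1 E0 E1 hE0 hE1 s hs u hu, hex T1 hT1 E0 E1 hE0 hE1 m hm u hu]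
        · obtain ⟨E, hE⟩ := hT T (Multiset.mem_cons_of_mem h)
          exact ⟨E, hE, fun s hs => (hex T h E0 E hE0 hE m hm s hs).symm⟩
      obtain ⟨c1, c2⟩ := forest_const m _ hall
      rw [hLS] at c1 c2
      have hmd := hd m c2
      have hm0 := hE0.edge_pos.2.1 m hm
      have hcard : 2 ≤ Multiset.card (T0 ::ₘ L1) := by
        have := Multiset.card_pos.2 h1
        simp; omega
      have hS1 : 1 ≤ Multiset.card S := Multiset.card_pos.2 hS
      have hcard' : (2 : ℤ) ≤ (Multiset.card (T0 ::ₘ L1) : ℤ) := by exact_mod_cast hcard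
      have hS1' : (1 : ℤ) ≤ (Multiset.card S : ℤ) := by exact_mod_cast hS1
      have hm0' : (0 : ℤ) < (m : ℤ) := by exact_mod_cast hm0
      have g1 := mul_le_mul_of_nonneg_right hmd (sub_nonneg.2 hS1')
      have g2 := mul_le_mul_of_nonneg_left hcard' hm0'.le
      nlinarith
open Equiv Equiv.Perm

lemma sc_le {X : Type} [Finite X] (τ : Perm X) (R : X → X → Prop) (hR : Equivalence R)
    (h : ∀ u, R u (τ u)) {u v : X} (huv : τ.SameCycle u v) : R u v := by
  obtain ⟨n, rfl⟩ := huv.exists_nat_pow_eq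
  clear huv
  induction n with
  | zero => exact hR.refl u
  | succ n ih =>
    rw [pow_succ', Perm.mul_apply]
    exact hR.trans ih (h _)

lemma sc_merge {X : Type} [Finite X] [DecidableEq X] (τ : Perm X) {x y : X}
    (hxy : ¬ τ.SameCycle x y) (u v : X) :
    (τ * swap x y).SameCycle u v ↔ τ.SameCycle u v ∨
      ((τ.SameCycle x u ∨ τ.SameCycle y u) ∧ (τ.SameCycle x v ∨ τ.SameCycle y v)) := by
  have ex : (τ * swap x y) x = τ y := by simp
  have ey : (τ * swap x y) y = τ x := by simp
  have eo : ∀ u, u ≠ x → u ≠ y → (τ * swap x y) u = τ u := fun u h1 h2 => by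
    simp [swap_apply_of_ne_of_ne h1 h2]
  have key : (τ * swap x y).SameCycle x y := by
    have h : ∀ j : ℕ, (τ * swap x y).SameCycle x ((τ ^ (j + 1)) y) := by
      intro j
      induction j with
      | zero =>
        rw [zero_add, pow_one, ← ex]
        exact sameCycle_apply_right.2 (SameCycle.refl _ _)
      | succ j ih =>
        rw [pow_succ', Perm.mul_apply]
        by_cases h1 : (τ ^ (j + 1)) y = y
        · rw [h1, ← ex]
          exact sameCycle_apply_right.2 (SameCycle.refl _ _)
        · rw [← eo _ _ h1]
          · exact sameCycle_apply_right.2 ih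
          · intro h2
            apply hxy
            rw [← h2]
            exact sameCycle_pow_left.2 (SameCycle.refl _ _)
    have h1 := h (orderOf τ - 1)
    rw [Nat.sub_add_cancel (orderOf_pos τ), pow_orderOf_eq_one] at h1
    exact h1
  have hsub : ∀ {u v}, τ.SameCycle u v → (τ * swap x y).SameCycle u v := by
    intro u v h
    refine sc_le τ _ (SameCycle.equivalence _) ?_ h
    intro u
    by_cases h1 : u = x
    · subst h1
      rw [← ey]
      exact sameCycle_apply_right.2 key
    by_cases h2 : u = y
    · subst h2
      rw [← ex]
      exact sameCycle_apply_right.2 key.symm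
    rw [← eo u h1 h2]
    exact sameCycle_apply_right.2 (SameCycle.refl _ _)
  constructor
  · intro h
    refine sc_le (τ * swap x y) (fun u v => τ.SameCycle u v ∨
      ((τ.SameCycle x u ∨ τ.SameCycle y u) ∧ (τ.SameCycle x v ∨ τ.SameCycle y v))) ?_ ?_ h
    · refine ⟨fun u => Or.inl (SameCycle.refl _ _), ?_, ?_⟩
      · rintro u v (h | h)
        · exact Or.inl h.symm
        · exact Or.inr ⟨h.2, h.1⟩
      · rintro u v w (h | ⟨h1, h2⟩) (h' | ⟨h1', h2'⟩)
        · exact Or.inl (h.trans h')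
        · exact Or.inr ⟨h1'.imp (fun k => k.trans h.symm) (fun k => k.trans h.symm), h2'⟩
        · exact Or.inr ⟨h1, h2.imp (fun k => k.trans h') (fun k => k.trans h')⟩
        · exact Or.inr ⟨h1, h2'⟩
    · intro u
      by_cases h1 : u = x
      · subst h1
        rw [ex]
        exact Or.inr ⟨Or.inl (SameCycle.refl _ _),
          Or.inr (sameCycle_apply_right.2 (SameCycle.refl _ _))⟩
      by_cases h2 : u = y
      · subst h2
        rw [ey]
        exact Or.inr ⟨Or.inr (SameCycle.refl _ _),
          Or.inl (sameCycle_apply_right.2 (SameCycle.refl _ _))⟩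
      rw [eo u h1 h2]
      exact Or.inl (sameCycle_apply_right.2 (SameCycle.refl _ _))
  · have hx : ∀ u, (τ.SameCycle x u ∨ τ.SameCycle y u) → (τ * swap x y).SameCycle x u := by
      rintro u (h | h)
      · exact hsub h
      · exact key.trans (hsub h)
    rintro (h | ⟨h1, h2⟩)
    · exact hsub h
    · exact (hx u h1).symm.trans (hx v h2)

section glue
variable {X Y : Type}

lemma sumCongr_zpow_eq (σ : Perm X) (τ : Perm Y) (n : ℤ) :
    (Perm.sumCongr σ τ : Perm (X ⊕ Y)) ^ n = Perm.sumCongr (σ ^ n) (τ ^ n) :=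
  (map_zpow (sumCongrHom X Y) (σ, τ) n).symm

lemma sc_ll (σ : Perm X) (τ : Perm Y) (u v : X) :
    SameCycle (Perm.sumCongr σ τ : Perm (X ⊕ Y)) (Sum.inl u) (Sum.inl v) ↔ σ.SameCycle u v := by
  simp [SameCycle, sumCongr_zpow_eq]
lemma sc_rr (σ : Perm X) (τ : Perm Y) (u v : Y) :
    SameCycle (Perm.sumCongr σ τ : Perm (X ⊕ Y)) (Sum.inr u) (Sum.inr v) ↔ τ.SameCycle u v := by
  simp [SameCycle, sumCongr_zpow_eq]
lemma sc_lr (σ : Perm X) (τ : Perm Y) (u : X) (v : Y) :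
    ¬ SameCycle (Perm.sumCongr σ τ : Perm (X ⊕ Y)) (Sum.inl u) (Sum.inr v) := by
  simp [SameCycle, sumCongr_zpow_eq]
lemma sc_rl (σ : Perm X) (τ : Perm Y) (u : X) (v : Y) :
    ¬ SameCycle (Perm.sumCongr σ τ : Perm (X ⊕ Y)) (Sum.inr v) (Sum.inl u) := by
  simp [SameCycle, sumCongr_zpow_eq]

/-- `ρ` is a permutation of the disjoint union whose cycles are those of `σ` and `τ`, except that
the cycles of `x` and `y` are merged. -/
structure Merged (σ : Perm X) (τ : Perm Y) (x : X) (y : Y) (ρ : Perm (X ⊕ Y)) : Prop where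
  ll : ∀ u v, ρ.SameCycle (Sum.inl u) (Sum.inl v) ↔ σ.SameCycle u v
  rr : ∀ u v, ρ.SameCycle (Sum.inr u) (Sum.inr v) ↔ τ.SameCycle u v
  lr : ∀ u v, ρ.SameCycle (Sum.inl u) (Sum.inr v) ↔ σ.SameCycle x u ∧ τ.SameCycle y v
  rl : ∀ u v, ρ.SameCycle (Sum.inr v) (Sum.inl u) ↔ σ.SameCycle x u ∧ τ.SameCycle y v

lemma merged_right [Finite X] [Finite Y] [DecidableEq (X ⊕ Y)] (σ : Perm X) (τ : Perm Y)
    (x : X) (y : Y) :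
    Merged σ τ x y ((Perm.sumCongr σ τ : Perm (X ⊕ Y)) * swap (Sum.inl x) (Sum.inr y)) := by
  have h := sc_merge (Perm.sumCongr σ τ : Perm (X ⊕ Y)) (sc_lr σ τ x y)
  constructor
  · intro u v
    rw [h]
    simp only [sc_ll, sc_rl, or_false, or_iff_left_iff_imp]
    exact fun h => h.1.symm.trans h.2
  · intro u v
    rw [h]
    simp only [sc_rr, sc_lr, false_or, or_iff_left_iff_imp]
    exact fun h => h.1.symm.trans h.2
  · intro u v
    rw [h]
    simp only [sc_ll, sc_rr, sc_lr, sc_rl, false_or, or_false]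
  · intro u v
    rw [h]
    simp only [sc_ll, sc_rr, sc_lr, sc_rl, false_or, or_false]
    exact and_comm

lemma merged_left [Finite X] [Finite Y] [DecidableEq (X ⊕ Y)] (σ : Perm X) (τ : Perm Y)
    (x : X) (y : Y) :
    Merged σ τ x y (swap (Sum.inl x) (Sum.inr y) * (Perm.sumCongr σ τ : Perm (X ⊕ Y))) := by
  have h := merged_right σ⁻¹ τ⁻¹ x y
  have e : (swap (Sum.inl x) (Sum.inr y) * (Perm.sumCongr σ τ : Perm (X ⊕ Y)))⁻¹ =
      (Perm.sumCongr σ⁻¹ τ⁻¹ : Perm (X ⊕ Y)) * swap (Sum.inl x) (Sum.inr y) := by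
    rw [mul_inv_rev, swap_inv]
    rfl
  rw [← e] at h
  constructor
  · simpa only [sameCycle_inv] using h.ll
  · simpa only [sameCycle_inv] using h.rr
  · simpa only [sameCycle_inv] using h.lr
  · simpa only [sameCycle_inv] using h.rl

/-- The length of the cycle through `x`. -/
noncomputable def clen {X : Type} (σ : Perm X) (x : X) : ℕ :=
  Nat.card {y // σ.SameCycle x y}

/-- The number of points in cycles of length `k`. -/
noncomputable def ccnt {X : Type} (σ : Perm X) (k : ℕ) : ℕ :=
  Nat.card {y // clen σ y = k}

lemma ncard_filter [Fintype X] (p : X → Prop) [DecidablePred p] :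
    Nat.card {x // p x} = (Finset.univ.filter p).card := by
  rw [Nat.card_eq_fintype_card, Fintype.card_subtype]

lemma clen_eq [Fintype X] (σ : Perm X) (x : X) [DecidablePred (fun y => σ.SameCycle x y)] :
    clen σ x = (Finset.univ.filter (fun y => σ.SameCycle x y)).card := ncard_filter _

lemma ccnt_eq [Fintype X] (σ : Perm X) (k : ℕ) :
    ccnt σ k = (Finset.univ.filter (fun y => clen σ y = k)).card := ncard_filter _

lemma clen_congr [Fintype X] {σ : Perm X} {x y : X} (h : σ.SameCycle x y) :
    clen σ x = clen σ y := by
  unfold clen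
  refine Nat.card_congr (Equiv.subtypeEquivRight fun z => ?_)
  exact ⟨fun k => h.symm.trans k, fun k => h.trans k⟩

lemma clen_inv [Fintype X] (σ : Perm X) (x : X) : clen σ⁻¹ x = clen σ x := by
  simp only [clen, sameCycle_inv]

lemma ccnt_inv [Fintype X] (σ : Perm X) (k : ℕ) : ccnt σ⁻¹ k = ccnt σ k := by
  simp only [ccnt, clen_inv]

lemma card_filter_sum [Fintype X] [Fintype Y] (p : X ⊕ Y → Prop) :
    Nat.card {z // p z} = Nat.card {u // p (Sum.inl u)} + Nat.card {u // p (Sum.inr u)} := by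
  classical
  simp only [ncard_filter, Finset.card_filter, Fintype.sum_sum_type]

lemma clen_sum_l [Fintype X] [Fintype Y] (σ : Perm X) (τ : Perm Y) (u : X) :
    clen (Perm.sumCongr σ τ : Perm (X ⊕ Y)) (Sum.inl u) = clen σ u := by
  classical
  unfold clen
  rw [card_filter_sum]
  simp [sc_ll, sc_lr]

lemma clen_sum_r [Fintype X] [Fintype Y] (σ : Perm X) (τ : Perm Y) (u : Y) :
    clen (Perm.sumCongr σ τ : Perm (X ⊕ Y)) (Sum.inr u) = clen τ u := by
  classical
  unfold clen
  rw [card_filter_sum]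
  simp [sc_rr, sc_rl]

lemma ccnt_sum [Fintype X] [Fintype Y] (σ : Perm X) (τ : Perm Y) (k : ℕ) :
    ccnt (Perm.sumCongr σ τ : Perm (X ⊕ Y)) k = ccnt σ k + ccnt τ k := by
  classical
  unfold ccnt
  rw [card_filter_sum]
  simp only [clen_sum_l, clen_sum_r]

open Classical in
lemma Merged.clen_l [Fintype X] [Fintype Y] {σ : Perm X} {τ : Perm Y} {x : X} {y : Y}
    {ρ : Perm (X ⊕ Y)} (h : Merged σ τ x y ρ) (u : X) :
    clen ρ (Sum.inl u) = if σ.SameCycle x u then clen σ x + clen τ y else clen σ u := by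
  split_ifs with hu
  · rw [clen_congr hu]
    unfold clen
    rw [card_filter_sum]
    simp only [h.ll, h.lr, hu, true_and]
  · unfold clen
    rw [card_filter_sum]
    simp [h.ll, h.lr, hu]

open Classical in
lemma Merged.clen_r [Fintype X] [Fintype Y] {σ : Perm X} {τ : Perm Y} {x : X} {y : Y}
    {ρ : Perm (X ⊕ Y)} (h : Merged σ τ x y ρ) (u : Y) :
    clen ρ (Sum.inr u) = if τ.SameCycle y u then clen σ x + clen τ y else clen τ u := by
  split_ifs with hu
  · rw [clen_congr hu]
    unfold clen
    rw [card_filter_sum]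
    simp only [h.rl, h.rr, hu, and_true]
  · unfold clen
    rw [card_filter_sum]
    simp [h.rl, h.rr, hu]

open Classical in
lemma cnt_mod [Fintype X] (σ : Perm X) (x : X) (N k : ℕ) :
    Nat.card {u // (if σ.SameCycle x u then N else clen σ u) = k} +
      (if clen σ x = k then clen σ x else 0) = ccnt σ k + (if N = k then clen σ x else 0) := by
  have e : ∀ (P : Prop) [Decidable P], (if P then clen σ x else 0) =
      ∑ u, if P ∧ σ.SameCycle x u then 1 else 0 := by
    intro P _
    by_cases hP : P
    · simp [hP, clen_eq]
    · simp [hP]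
  rw [e, e, ccnt_eq, ncard_filter, Finset.card_filter, Finset.card_filter, ← Finset.sum_add_distrib,
    ← Finset.sum_add_distrib]
  refine Finset.sum_congr rfl fun u _ => ?_
  by_cases hu : σ.SameCycle x u
  · simp only [hu, and_true, if_true, clen_congr hu]
    ring
  · simp [hu]

open Classical in
lemma Merged.ccnt [Fintype X] [Fintype Y] {σ : Perm X} {τ : Perm Y} {x : X} {y : Y}
    {ρ : Perm (X ⊕ Y)} (h : Merged σ τ x y ρ) (k : ℕ) :
    ccnt ρ k + (if clen σ x = k then k else 0) + (if clen τ y = k then k else 0) =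
      _root_.ccnt σ k + _root_.ccnt τ k + (if clen σ x + clen τ y = k then k else 0) := by
  have e : _root_.ccnt ρ k = _ := card_filter_sum _
  simp only [h.clen_l, h.clen_r] at e
  have h1 := cnt_mod σ x (clen σ x + clen τ y) k
  have h2 := cnt_mod τ y (clen σ x + clen τ y) k
  split_ifs at h1 h2 ⊢ <;> omega

end glue

/-- A planar system of permutations realizing the multiset `S`. -/
structure Sys (S : Multiset ℤ) (X : Type) [Fintype X] (σ₁ σ₂ σ₃ : Perm X) (c : X) : Prop where
  prod : σ₁ * σ₂ * σ₃ = 1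
  fix : ∀ x, σ₂.SameCycle c x ∨ σ₂ x = x
  card_c : clen σ₂ c + 1 = Multiset.card S
  meet1 : ∀ x, ∃ y, σ₁.SameCycle x y ∧ σ₂.SameCycle c y
  meet3 : ∀ x, ∃ y, σ₃.SameCycle x y ∧ σ₂.SameCycle c y
  cnt1 : ∀ k : ℕ, 0 < k → ccnt σ₁ k = k * S.count (k : ℤ)
  cnt3 : ∀ k : ℕ, 0 < k → ccnt σ₃ k = k * S.count (-(k : ℤ))
  card1 : Fintype.card X = (S.map Int.toNat).sum
  card3 : Fintype.card X = (S.map (fun a => Int.toNat (-a))).sum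

/-- Realizability by a system. -/
def Rlz (S : Multiset ℤ) : Prop :=
  ∃ (X : Type) (_ : Fintype X) (σ₁ σ₂ σ₃ : Perm X) (c : X), Sys S X σ₁ σ₂ σ₃ c

lemma Rlz.neg {S : Multiset ℤ} (h : Rlz S) : Rlz (S.map (fun a => -a)) := by
  obtain ⟨X, _, σ₁, σ₂, σ₃, c, h⟩ := h
  have hc : ∀ a : ℤ, (S.map (fun a => -a)).count a = S.count (-a) := by
    intro a
    have := Multiset.count_map_eq_count' (fun a : ℤ => -a) S neg_injective (-a)
    simpa using this
  refine ⟨X, _, σ₃⁻¹, σ₂⁻¹, σ₁⁻¹, c, ?_, ?_, ?_, ?_, ?_, ?_, ?_, ?_, ?_⟩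
  · rw [← mul_inv_rev, ← mul_inv_rev, ← mul_assoc, h.prod, inv_one]
  · intro x
    rw [sameCycle_inv]
    refine (h.fix x).imp id fun hx => ?_
    rw [Perm.inv_eq_iff_eq, hx]
  · rw [clen_inv, h.card_c]; simp
  · simpa only [sameCycle_inv] using h.meet3
  · simpa only [sameCycle_inv] using h.meet1
  · intro k hk
    rw [ccnt_inv, hc, h.cnt3 k hk]
  · intro k hk
    rw [ccnt_inv, hc, neg_neg, h.cnt1 k hk]
  · rw [h.card3, Multiset.map_map]; rfl
  · rw [h.card1, Multiset.map_map]
    simp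

lemma exists_point {S : Multiset ℤ} {X : Type} [Fintype X] {σ₁ σ₂ σ₃ : Perm X} {c : X}
    (h : Sys S X σ₁ σ₂ σ₃ c) (a : ℕ) (ha : 0 < a) (hm : (a : ℤ) ∈ S) :
    ∃ x, clen σ₁ x = a ∧ σ₂.SameCycle c x := by
  classical
  have h1 := h.cnt1 a ha
  have h2 : 0 < S.count (a : ℤ) := Multiset.count_pos.2 hm
  have h3 : 0 < ccnt σ₁ a := by rw [h1]; positivity
  obtain ⟨x, hx⟩ := Finset.card_pos.1 (ccnt_eq σ₁ a ▸ h3)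
  simp only [Finset.mem_filter, Finset.mem_univ, true_and] at hx
  obtain ⟨y, hy1, hy2⟩ := h.meet1 x
  exact ⟨y, by rw [← clen_congr hy1, hx], hy2⟩

lemma Rlz.glue_pos {S T : Multiset ℤ} (a b : ℕ) (ha : 0 < a) (hb : 0 < b)
    (hS : Rlz ((a : ℤ) ::ₘ S)) (hT : Rlz ((b : ℤ) ::ₘ T)) :
    Rlz (((a : ℤ) + b) ::ₘ (S + T)) := by
  classical
  obtain ⟨X, _, σ₁, σ₂, σ₃, c, h⟩ := hS
  obtain ⟨Y, _, τ₁, τ₂, τ₃, d, k⟩ := hT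
  obtain ⟨x, hx1, hx2⟩ := exists_point h a ha (Multiset.mem_cons_self _ _)
  obtain ⟨y, hy1, hy2⟩ := exists_point k b hb (Multiset.mem_cons_self _ _)
  have m1 := merged_right σ₁ τ₁ x y
  have m2 := merged_left σ₂ τ₂ x y
  have hX : ∀ u, (swap (Sum.inl x) (Sum.inr y) * (Perm.sumCongr σ₂ τ₂ : Perm (X ⊕ Y))).SameCycle
      (Sum.inl x) (Sum.inl u) ↔ σ₂.SameCycle c u := by
    intro u
    rw [m2.ll]
    exact ⟨fun h => hx2.trans h, fun h => hx2.symm.trans h⟩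
  have hY : ∀ u, (swap (Sum.inl x) (Sum.inr y) * (Perm.sumCongr σ₂ τ₂ : Perm (X ⊕ Y))).SameCycle
      (Sum.inl x) (Sum.inr u) ↔ τ₂.SameCycle d u := by
    intro u
    rw [m2.lr]
    exact ⟨fun h => hy2.trans h.2, fun h => ⟨SameCycle.refl _ _, hy2.symm.trans h⟩⟩
  refine ⟨X ⊕ Y, inferInstance, (Perm.sumCongr σ₁ τ₁ : Perm (X ⊕ Y)) * swap (Sum.inl x) (Sum.inr y),
    swap (Sum.inl x) (Sum.inr y) * (Perm.sumCongr σ₂ τ₂ : Perm (X ⊕ Y)), Perm.sumCongr σ₃ τ₃, Sum.inl x,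
    ?_, ?_, ?_, ?_, ?_, ?_, ?_, ?_, ?_⟩
  · have e1 : (Perm.sumCongr σ₁ τ₁ : Perm (X ⊕ Y)) * Perm.sumCongr σ₂ τ₂ * Perm.sumCongr σ₃ τ₃ = 1 := by
      have : (Perm.sumCongr σ₁ τ₁ : Perm (X ⊕ Y)) * Perm.sumCongr σ₂ τ₂ * Perm.sumCongr σ₃ τ₃ =
        Perm.sumCongr (σ₁ * σ₂ * σ₃) (τ₁ * τ₂ * τ₃) := by
          ext z; cases z <;> rfl
      rw [this, h.prod, k.prod]
      ext z; cases z <;> rfl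
    rw [← e1]
    simp only [mul_assoc]
    rw [← mul_assoc (swap _ _) (swap _ _), swap_mul_self, one_mul]
  · rintro (u | u)
    · rw [hX]
      by_cases hu : σ₂.SameCycle c u
      · exact Or.inl hu
      · right
        have e := (h.fix u).resolve_left hu
        have hne : u ≠ x := fun e => hu (e ▸ hx2)
        rw [Perm.mul_apply, Perm.sumCongr_apply, Sum.map_inl, e, swap_apply_of_ne_of_ne]
        · simpa using hne
        · simp
    · rw [hY]
      by_cases hu : τ₂.SameCycle d u
      · exact Or.inl hu
      · right
        have e := (k.fix u).resolve_left hu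
        have hne : u ≠ y := fun e => hu (e ▸ hy2)
        rw [Perm.mul_apply, Perm.sumCongr_apply, Sum.map_inr, e, swap_apply_of_ne_of_ne]
        · simp
        · simpa using hne
  · rw [m2.clen_l, if_pos (SameCycle.refl _ _), ← clen_congr hx2, ← clen_congr hy2]
    have h1 := h.card_c
    have h2 := k.card_c
    simp only [Multiset.card_cons, Multiset.card_add] at h1 h2 ⊢
    omega
  · rintro (u | u)
    · obtain ⟨v, hv1, hv2⟩ := h.meet1 u
      exact ⟨Sum.inl v, (m1.ll _ _).2 hv1, (hX v).2 hv2⟩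
    · obtain ⟨v, hv1, hv2⟩ := k.meet1 u
      exact ⟨Sum.inr v, (m1.rr _ _).2 hv1, (hY v).2 hv2⟩
  · rintro (u | u)
    · obtain ⟨v, hv1, hv2⟩ := h.meet3 u
      exact ⟨Sum.inl v, (sc_ll _ _ _ _).2 hv1, (hX v).2 hv2⟩
    · obtain ⟨v, hv1, hv2⟩ := k.meet3 u
      exact ⟨Sum.inr v, (sc_rr _ _ _ _).2 hv1, (hY v).2 hv2⟩
  · intro l hl
    have h1 := m1.ccnt l
    rw [h.cnt1 l hl, k.cnt1 l hl, hx1, hy1] at h1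
    simp only [Multiset.count_cons, Multiset.count_add] at h1 ⊢
    have e1 : ((l : ℤ) = a) ↔ a = l := by omega
    have e2 : ((l : ℤ) = b) ↔ b = l := by omega
    have e3 : ((l : ℤ) = a + b) ↔ a + b = l := by omega
    simp only [e1, e2, e3, mul_add, mul_ite, mul_one, mul_zero] at h1 ⊢
    omega
  · intro l hl
    rw [ccnt_sum, h.cnt3 l hl, k.cnt3 l hl]
    have e1 : ¬ (-(l : ℤ) = a) := by omega
    have e2 : ¬ (-(l : ℤ) = b) := by omega
    have e3 : ¬ (-(l : ℤ) = a + b) := by omega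
    simp only [Multiset.count_cons, Multiset.count_add, e1, e2, e3, if_false]
    ring
  · rw [Fintype.card_sum, h.card1, k.card1]
    simp only [Multiset.map_cons, Multiset.sum_cons, Multiset.map_add, Multiset.sum_add]
    omega
  · rw [Fintype.card_sum, h.card3, k.card3]
    simp only [Multiset.map_cons, Multiset.sum_cons, Multiset.map_add, Multiset.sum_add]
    omega

lemma Rlz.base (a : ℕ) (ha : 0 < a) : Rlz {(a : ℤ), -(a : ℤ)} := by
  classical
  obtain ⟨m, rfl⟩ : ∃ m, a = m + 1 := ⟨a - 1, by omega⟩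
  have hs : ∀ u v : Fin (m + 1), (finRotate (m + 1)).SameCycle u v := by
    intro u v
    have h0 : ∀ w : Fin (m + 1), (finRotate (m + 1)).SameCycle 0 w := by
      intro w
      induction w using Fin.induction with
      | zero => exact SameCycle.refl _ _
      | succ i ih =>
        have : finRotate (m + 1) i.castSucc = i.succ := by
          rw [finRotate_apply]; simp
        rw [← this]
        exact sameCycle_apply_right.2 ih
    exact (h0 u).symm.trans (h0 v)
  have hl : ∀ u, clen (finRotate (m + 1)) u = m + 1 := by
    intro u
    simp [clen_eq, hs]
  have hcnt : ∀ k : ℕ, ccnt (finRotate (m + 1)) k = if k = m + 1 then m + 1 else 0 := by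
    intro k
    unfold ccnt
    simp only [hl]
    split_ifs with h
    · simp [h]
    · have : ¬ m + 1 = k := fun e => h e.symm
      simp only [this]
      simp
  refine ⟨Fin (m + 1), inferInstance, finRotate (m + 1), 1, (finRotate (m + 1))⁻¹, 0,
    ?_, ?_, ?_, ?_, ?_, ?_, ?_, ?_, ?_⟩
  · simp
  · intro x; right; rfl
  · simp [clen_eq, sameCycle_one, Finset.filter_eq]
  · intro x
    exact ⟨0, hs _ _, SameCycle.refl _ _⟩
  · intro x
    exact ⟨0, sameCycle_inv.2 (hs _ _), SameCycle.refl _ _⟩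
  · intro k hk
    rw [hcnt, Multiset.insert_eq_cons, Multiset.count_cons, Multiset.count_singleton]
    have e1 : ((k : ℤ) = ((m + 1 : ℕ) : ℤ)) ↔ k = m + 1 := by omega
    have e2 : ¬ ((k : ℤ) = -((m + 1 : ℕ) : ℤ)) := by omega
    simp only [e1, e2, if_false]
    split_ifs with h <;> simp [h]
  · intro k hk
    rw [ccnt_inv, hcnt, Multiset.insert_eq_cons, Multiset.count_cons, Multiset.count_singleton]
    have e1 : (-(k : ℤ) = -((m + 1 : ℕ) : ℤ)) ↔ k = m + 1 := by omega
    have e2 : ¬ (-(k : ℤ) = ((m + 1 : ℕ) : ℤ)) := by omega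
    simp only [e1, e2, if_false]
    split_ifs with h <;> simp [h]
  · simp only [Fintype.card_fin, Multiset.insert_eq_cons, Multiset.map_cons, Multiset.sum_cons,
      Multiset.map_singleton, Multiset.sum_singleton]
    omega
  · simp only [Fintype.card_fin, Multiset.insert_eq_cons, Multiset.map_cons, Multiset.sum_cons,
      Multiset.map_singleton, Multiset.sum_singleton]
    omega

/-- The cycle type is determined by the point counts. -/
lemma cycleType_of_ccnt {X : Type} [Fintype X] [DecidableEq X] (σ : Perm X) (P : Multiset ℕ)
    (hP : ∀ k ∈ P, 2 ≤ k) (h : ∀ k, 2 ≤ k → ccnt σ k = k * P.count k) : σ.cycleType = P := by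
  ext k
  by_cases hk : 2 ≤ k
  swap
  · rw [Multiset.count_eq_zero.2 (fun h => hk (two_le_of_mem_cycleType h)),
      Multiset.count_eq_zero.2 (fun h => hk (hP k h))]
  have hcl : ∀ x, σ x ≠ x → clen σ x = (σ.cycleOf x).support.card := by
    intro x hx
    rw [clen_eq]
    congr 1
    ext y
    simp only [Finset.mem_filter, Finset.mem_univ, true_and]
    rw [mem_support_cycleOf_iff' hx]
  have hcl1 : ∀ x, σ x = x → clen σ x = 1 := by
    intro x hx
    rw [clen_eq]
    rw [Finset.card_eq_one]
    refine ⟨x, ?_⟩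
    ext y
    simp only [Finset.mem_filter, Finset.mem_univ, true_and, Finset.mem_singleton]
    exact ⟨fun h => (h.eq_of_left hx).symm, fun h => h ▸ SameCycle.refl _ _⟩
  have key : ccnt σ k = k * σ.cycleType.count k := by
    have e : (Finset.univ.filter (fun y => clen σ y = k)) =
        (σ.cycleFactorsFinset.filter (fun c => c.support.card = k)).biUnion (fun c => c.support) := by
      ext x
      simp only [Finset.mem_filter, Finset.mem_univ, true_and, Finset.mem_biUnion]
      constructor
      · intro hx
        have hne : σ x ≠ x := fun e => by have := hcl1 x e; omega
        refine ⟨σ.cycleOf x, ⟨?_, ?_⟩, ?_⟩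
        · rw [cycleOf_mem_cycleFactorsFinset_iff]; exact mem_support.2 hne
        · rw [← hcl x hne, hx]
        · rw [mem_support_cycleOf_iff' hne]
      · rintro ⟨c, ⟨hc1, hc2⟩, hc3⟩
        have hne : σ x ≠ x := mem_support.1 (mem_cycleFactorsFinset_support_le hc1 hc3)
        rw [hcl x hne, ← cycle_is_cycleOf hc3 hc1, hc2]
    rw [ccnt_eq]
    have e' := congrArg Finset.card e
    rw [Finset.card_biUnion] at e'
    · rw [Finset.sum_congr rfl (fun c hc => (Finset.mem_filter.1 hc).2), Finset.sum_const,
        smul_eq_mul] at e'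
      rw [cycleType_def, Multiset.count_map, mul_comm]
      convert e' using 2
      rw [← Finset.filter_val, Finset.card_val]
      congr 1
      ext c
      simp [eq_comm]
    · intro c hc d hd hcd
      exact (cycleFactorsFinset_pairwise_disjoint σ (Finset.mem_filter.1 hc).1
        (Finset.mem_filter.1 hd).1 hcd).disjoint_support
  rw [h k hk] at key
  exact (Nat.eq_of_mul_eq_mul_left (by omega) key).symm

lemma WTree.rlz {S : Multiset ℤ} {E : Multiset ℕ} (h : WTree S E) : Rlz S := by
  induction h with
  | base a ha => exact Rlz.base a ha
  | glue a b S T E F hab h1 h2 ih1 ih2 =>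
    rcases pos_and_pos_or_neg_and_neg_of_mul_pos hab with ⟨ha, hb⟩ | ⟨ha, hb⟩
    · lift a to ℕ using ha.le
      lift b to ℕ using hb.le
      exact Rlz.glue_pos a b (by omega) (by omega) ih1 ih2
    · obtain ⟨a, rfl⟩ : ∃ c : ℕ, a = -(c : ℤ) := ⟨a.natAbs, by omega⟩
      obtain ⟨b, rfl⟩ : ∃ c : ℕ, b = -(c : ℤ) := ⟨b.natAbs, by omega⟩
      have j1 := ih1.neg
      have j2 := ih2.neg
      rw [Multiset.map_cons, neg_neg] at j1 j2
      have := (Rlz.glue_pos a b (by omega) (by omega) j1 j2).neg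
      simpa [Multiset.map_map, add_comm] using this

/-- Transport of a system along a bijection. -/
lemma Sys.transport {S : Multiset ℤ} {X Y : Type} [Fintype X] [Fintype Y] {σ₁ σ₂ σ₃ : Perm X}
    {c : X} (h : Sys S X σ₁ σ₂ σ₃ c) (e : X ≃ Y) :
    Sys S Y (e.permCongrHom σ₁) (e.permCongrHom σ₂) (e.permCongrHom σ₃) (e c) := by
  classical
  have hsc : ∀ (σ : Perm X) (u v : X), (e.permCongrHom σ).SameCycle (e u) (e v) ↔
      σ.SameCycle u v := by
    intro σ u v
    unfold SameCycle
    refine exists_congr fun n => ?_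
    rw [← map_zpow]
    simp
  have hlen : ∀ (σ : Perm X) (u : X), clen (e.permCongrHom σ) (e u) = clen σ u := by
    intro σ u
    rw [clen_eq, clen_eq, Finset.card_filter, Finset.card_filter, ← e.sum_comp]
    simp only [hsc]
  have hcnt : ∀ (σ : Perm X) (k : ℕ), ccnt (e.permCongrHom σ) k = ccnt σ k := by
    intro σ k
    rw [ccnt_eq, ccnt_eq, Finset.card_filter, Finset.card_filter, ← e.sum_comp]
    simp only [hlen]
  refine ⟨?_, ?_, ?_, ?_, ?_, ?_, ?_, ?_, ?_⟩
  · rw [← map_mul, ← map_mul, h.prod, map_one]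
  · intro y
    obtain ⟨x, rfl⟩ := e.surjective y
    rw [hsc]
    refine (h.fix x).imp id fun hx => ?_
    simp [hx]
  · rw [hlen, h.card_c]
  · intro y
    obtain ⟨x, rfl⟩ := e.surjective y
    obtain ⟨z, h1, h2⟩ := h.meet1 x
    exact ⟨e z, (hsc _ _ _).2 h1, (hsc _ _ _).2 h2⟩
  · intro y
    obtain ⟨x, rfl⟩ := e.surjective y
    obtain ⟨z, h1, h2⟩ := h.meet3 x
    exact ⟨e z, (hsc _ _ _).2 h1, (hsc _ _ _).2 h2⟩
  · intro k hk; rw [hcnt, h.cnt1 k hk]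
  · intro k hk; rw [hcnt, h.cnt3 k hk]
  · rw [← Fintype.card_congr e, h.card1]
  · rw [← Fintype.card_congr e, h.card3]

lemma Sys.cycleType2 {S : Multiset ℤ} {X : Type} [Fintype X] [DecidableEq X] {σ₁ σ₂ σ₃ : Perm X}
    {c : X} (h : Sys S X σ₁ σ₂ σ₃ c) :
    σ₂.cycleType = ({Multiset.card S - 1} : Multiset ℕ).filter (fun x => 2 ≤ x) := by
  apply cycleType_of_ccnt
  · intro k hk
    exact (Multiset.mem_filter.1 hk).2
  · intro k hk
    have hc : Multiset.card S - 1 = clen σ₂ c := by have := h.card_c; omega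
    rw [hc, Multiset.count_filter_of_pos hk, Multiset.count_singleton]
    have hfix : ∀ x, ¬ σ₂.SameCycle c x → clen σ₂ x = 1 := by
      intro x hx
      have hx := (h.fix x).resolve_left hx
      rw [clen_eq]
      rw [Finset.card_eq_one]
      refine ⟨x, ?_⟩
      ext y
      simp only [Finset.mem_filter, Finset.mem_univ, true_and, Finset.mem_singleton]
      exact ⟨fun h => (h.eq_of_left hx).symm, fun h => h ▸ SameCycle.refl _ _⟩
    split_ifs with hkc
    · rw [mul_one]
      conv_rhs => rw [hkc]
      rw [ccnt_eq]
      rw [clen_eq]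
      congr 1
      ext x
      simp only [Finset.mem_filter, Finset.mem_univ, true_and]
      constructor
      · intro hx
        by_contra hcon
        have := hfix x hcon
        omega
      · intro hx
        rw [← clen_congr hx, hkc]
    · rw [mul_zero]
      rw [ccnt_eq]
      rw [Finset.card_eq_zero, Finset.filter_eq_empty_iff]
      intro x _ hx
      by_cases hcx : σ₂.SameCycle c x
      · exact hkc (by rw [clen_congr hcx, hx])
      · have := hfix x hcx
        omega

open Classical in
/-- Let `A ∈ ℤ^r` with `∑ A i = 0`, all `A i ≠ 0`, `n_A = ∑ max(A i, 0)` and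
`k_A = gcd(A 1, …, A r)`.  If `k_A · (r - 1) ≤ n_A`, then there is a generating system
`(σ1, σ2, σ3)` of degree `n_A`: `σ1 σ2 σ3 = 1`, the subgroup `⟨σ1, σ2, σ3⟩` is transitive,
`σ1` has cycle type the positive `A i` (plus fixed points), `σ2` is an `(r-1)`-cycle (plus
fixed points), and `σ3` has cycle type the absolute values of the negative `A i` (plus
fixed points).  (Mathlib's `cycleType` omits fixed points, so `1`s are filtered out.) -/
theorem stmt10 (r : ℕ) (hr : 2 ≤ r) (A : Fin r → ℤ) (hA0 : ∀ i, A i ≠ 0)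
    (hsum : ∑ i, A i = 0) (nA : ℕ) (hnA : (nA : ℤ) = ∑ i, max (A i) 0)
    (hineq : Finset.univ.gcd A * ((r : ℤ) - 1) ≤ ∑ i, max (A i) 0) :
    ∃ σ1 σ2 σ3 : Equiv.Perm (Fin nA),
      σ1 * σ2 * σ3 = 1
      ∧ (∀ x y : Fin nA, ∃ g ∈ Subgroup.closure {σ1, σ2, σ3}, g x = y)
      ∧ σ1.cycleType
          = (Finset.univ.filter (fun i => 2 ≤ A i)).val.map (fun i => (A i).toNat)
      ∧ σ2.cycleType = ({r - 1} : Multiset ℕ).filter (fun x => 2 ≤ x)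
      ∧ σ3.cycleType
          = (Finset.univ.filter (fun i => A i ≤ -2)).val.map (fun i => (-A i).toNat) := by
  set S : Multiset ℤ := Finset.univ.val.map A with hS
  have hcard : Multiset.card S = r := by simp [hS]
  have hmax : (S.map (fun a => max a 0)).sum = ∑ i, max (A i) 0 := by
    rw [hS, Multiset.map_map]; rfl
  have hne : S ≠ 0 := by
    intro h
    rw [h] at hcard
    simp at hcard
    omega
  obtain ⟨L, hL1, hL2⟩ := exists_forest _ S le_rfl hsum (by
    intro a ha
    obtain ⟨i, _, rfl⟩ := Multiset.mem_map.1 ha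
    exact hA0 i)
  obtain ⟨E, hE⟩ := forest_to_tree (Finset.univ.gcd A) S (by
    intro m hm
    have hdvd : m ∣ Finset.univ.gcd A := Finset.dvd_gcd fun i _ =>
      hm _ (Multiset.mem_map_of_mem A (Finset.mem_univ i))
    refine Int.le_of_dvd ?_ hdvd
    have h0 : Finset.univ.gcd A ≠ 0 := by
      intro h
      exact hA0 ⟨0, by omega⟩ (Finset.gcd_eq_zero_iff.1 h _ (Finset.mem_univ _))
    have h1 : 0 ≤ Finset.univ.gcd A := by
      rw [← Finset.normalize_gcd, ← Int.abs_eq_normalize]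
      exact abs_nonneg _
    omega) hne (by rw [hcard, hmax]; exact hineq) _ L le_rfl hL1 hL2
  obtain ⟨X, _, σ₁, σ₂, σ₃, c, hsys⟩ := hE.rlz
  have hX : Fintype.card X = nA := by
    have h1 := hsys.card1
    have h2 : (nA : ℤ) = ((S.map Int.toNat).sum : ℕ) := by
      rw [hnA, ← hmax, Nat.cast_multiset_sum, Multiset.map_map Nat.cast]
      congr 1
      refine Multiset.map_congr rfl fun a _ => ?_
      simp
    rw [h1]
    exact_mod_cast h2.symm
  have h := hsys.transport (Fintype.equivFinOfCardEq hX)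
  generalize (Fintype.equivFinOfCardEq hX).permCongrHom σ₁ = τ₁ at h
  generalize (Fintype.equivFinOfCardEq hX).permCongrHom σ₂ = τ₂ at h
  generalize (Fintype.equivFinOfCardEq hX).permCongrHom σ₃ = τ₃ at h
  generalize (Fintype.equivFinOfCardEq hX) c = d at h
  refine ⟨τ₁, τ₂, τ₃, h.prod, ?_, ?_, ?_, ?_⟩
  · have m1 : τ₁ ∈ Subgroup.closure {τ₁, τ₂, τ₃} := Subgroup.subset_closure (by simp)
    have m2 : τ₂ ∈ Subgroup.closure {τ₁, τ₂, τ₃} := Subgroup.subset_closure (by simp)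
    have hd : ∀ x, ∃ g ∈ Subgroup.closure {τ₁, τ₂, τ₃}, g x = d := by
      intro x
      obtain ⟨y, ⟨i, hi⟩, hj⟩ := h.meet1 x
      obtain ⟨j, hj⟩ := hj.symm
      refine ⟨τ₂ ^ j * τ₁ ^ i, mul_mem (zpow_mem m2 _) (zpow_mem m1 _), ?_⟩
      rw [Perm.mul_apply, hi, hj]
    intro x y
    obtain ⟨g, hg, hgx⟩ := hd x
    obtain ⟨g', hg', hgy⟩ := hd y
    refine ⟨g'⁻¹ * g, mul_mem (inv_mem hg') hg, ?_⟩
    rw [Perm.mul_apply, hgx, Perm.inv_eq_iff_eq, hgy]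
  · apply cycleType_of_ccnt
    · intro k hk
      obtain ⟨i, hi, rfl⟩ := Multiset.mem_map.1 hk
      have : 2 ≤ A i := by simpa using hi
      omega
    · intro k hk
      rw [h.cnt1 k (by omega), hS, Multiset.count_map, Multiset.count_map, Finset.filter_val,
        Multiset.filter_filter]
      congr 2
      refine Multiset.filter_congr fun i _ => ?_
      omega
  · rw [h.cycleType2, hcard]
  · apply cycleType_of_ccnt
    · intro k hk
      obtain ⟨i, hi, rfl⟩ := Multiset.mem_map.1 hk
      have : A i ≤ -2 := by simpa using hi
      omega
    · intro k hk
      rw [h.cnt3 k (by omega), hS, Multiset.count_map, Multiset.count_map, Finset.filter_val,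
        Multiset.filter_filter]
      congr 2
      refine Multiset.filter_congr fun i _ => ?_
      omega
end
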